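/- Let R be a ring in which (3 : R) ≠ 0. Then there do not exist a, b ∈ R with a² = 1, b² = 1, and a²*b + a*b*a + b*a² = 0. -/

import Mathlib

theorem incompatibility_n3 {R : Type*} [Ring R] (h3 : (3 : R) ≠ 0) :
    ¬ ∃ a b : R, a ^ 2 = 1 ∧ b ^ 2 = 1 ∧ a ^ 2 * b + a * b * a + b * a ^ 2 = 0 := by
  rintro ⟨a, b, ha, hb, h⟩
  rw [ha, one_mul, mul_one] at h
  have h1 : a * b * a = -(b + b) := by
    rw [eq_neg_iff_add_eq_zero, ← h]
    abel
  rw [sq] at ha hb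
  have h2 : (a * b * a) * (a * b * a) = 1 := by
    calc (a * b * a) * (a * b * a) = a * (b * (a * a) * b) * a := by simp only [mul_assoc]
      _ = 1 := by rw [ha, mul_one, hb, mul_one, ha]
  rw [h1, neg_mul_neg, mul_add, add_mul, hb] at h2
  apply h3
  have h4 : (3 : R) = (1 + 1 + (1 + 1)) - 1 := by norm_num
  rw [h4, h2, sub_self]
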